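/- (Bernoulli) Let (K_n)_{n≥0} be a sequence of complex numbers with K_i ≠ K_{i-1} for all i ≥ 1. Consider the continued fraction with constant term b_0 = K_0 and partial numerators and denominators a_1 = K_1 − K_0, d_1 = 1; a_2 = K_1 − K_2, d_2 = K_2 − K_0; and for n ≥ 3, a_n = (K_{n-2} − K_{n-3})(K_{n-1} − K_n), d_n = K_n − K_{n-2}. Then for every N ≥ 0, the canonical denominator B_N is nonzero and A_N = K_N · B_N; in particular the N-th approximant A_N/B_N equals K_N. -/

import Mathlib

open Filter Topology Polynomial

/-- Canonical numerators `A` of the continued fraction `b₀ + K(aₙ/bₙ)`,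
shifted so that `cfA b₀ a b (n+1) = A_n` (and `cfA b₀ a b 0 = A_{-1} = 1`). -/
noncomputable def cfA (b₀ : ℂ) (a b : ℕ → ℂ) : ℕ → ℂ
  | 0 => 1
  | 1 => b₀
  | n + 2 => b (n + 1) * cfA b₀ a b (n + 1) + a (n + 1) * cfA b₀ a b n

/-- Canonical denominators `B` of the continued fraction `b₀ + K(aₙ/bₙ)`,
shifted so that `cfB b₀ a b (n+1) = B_n` (and `cfB b₀ a b 0 = B_{-1} = 0`). -/
noncomputable def cfB (b₀ : ℂ) (a b : ℕ → ℂ) : ℕ → ℂ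
  | 0 => 0
  | 1 => 1
  | n + 2 => b (n + 1) * cfB b₀ a b (n + 1) + a (n + 1) * cfB b₀ a b n

/-- The canonical denominators of Bernoulli's continued fraction grow by the factor
`K (n + 1) - K n` at each step. -/
theorem cfB_bernoulli_succ (K a d : ℕ → ℂ)
    (hd1 : d 1 = 1)
    (ha2 : a 2 = K 1 - K 2)
    (hd2 : d 2 = K 2 - K 0)
    (han : ∀ n : ℕ, 3 ≤ n → a n = (K (n - 2) - K (n - 3)) * (K (n - 1) - K n))
    (hdn : ∀ n : ℕ, 3 ≤ n → d n = K n - K (n - 2)) (n : ℕ) :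
    cfB (K 0) a d (n + 3) = (K (n + 1) - K n) * cfB (K 0) a d (n + 2) := by
  induction n with
  | zero => simp [cfB, hd1, ha2, hd2]
  | succ n ih =>
    have ha := han (n + 3) (by lia)
    have hd := hdn (n + 3) (by lia)
    simp only [Nat.add_sub_cancel, show n + 3 - 2 = n + 1 by lia,
      show n + 3 - 1 = n + 2 by lia] at ha hd
    have hB : cfB (K 0) a d (n + 4) =
        d (n + 3) * cfB (K 0) a d (n + 3) + a (n + 3) * cfB (K 0) a d (n + 2) := by
      rw [cfB]
    rw [show n + 1 + 3 = n + 4 by lia, show n + 1 + 2 = n + 3 by lia,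
      show n + 1 + 1 = n + 2 by lia, hB, ha, hd]
    linear_combination (K (n + 3) - K (n + 2)) * ih

/-- The canonical denominators of Bernoulli's continued fraction do not vanish. -/
theorem cfB_bernoulli_ne_zero (K a d : ℕ → ℂ)
    (hK : ∀ i : ℕ, 1 ≤ i → K i ≠ K (i - 1))
    (hd1 : d 1 = 1)
    (hB : ∀ n, cfB (K 0) a d (n + 3) = (K (n + 1) - K n) * cfB (K 0) a d (n + 2)) (n : ℕ) :
    cfB (K 0) a d (n + 2) ≠ 0 := by
  induction n with
  | zero => simp [cfB, hd1]
  | succ n ih =>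
    rw [show n + 1 + 2 = n + 3 by lia, hB n]
    exact mul_ne_zero (sub_ne_zero.mpr (hK (n + 1) (by lia))) ih

/-- The value `K n` of the `n`-th approximant of Bernoulli's continued fraction,
in denominator-free form. -/
theorem cfA_bernoulli (K a d : ℕ → ℂ)
    (ha1 : a 1 = K 1 - K 0)
    (hd1 : d 1 = 1)
    (ha2 : a 2 = K 1 - K 2)
    (hd2 : d 2 = K 2 - K 0)
    (han : ∀ n : ℕ, 3 ≤ n → a n = (K (n - 2) - K (n - 3)) * (K (n - 1) - K n))
    (hdn : ∀ n : ℕ, 3 ≤ n → d n = K n - K (n - 2)) (n : ℕ) :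
    cfA (K 0) a d (n + 1) = K n * cfB (K 0) a d (n + 1) := by
  induction n using Nat.strong_induction_on with
  | _ n ih =>
    match n with
    | 0 => simp [cfA, cfB]
    | 1 => simp [cfA, cfB, ha1, hd1]
    | 2 =>
      simp [cfA, cfB, ha1, hd1, ha2, hd2]
      ring
    | n + 3 =>
      have ha := han (n + 3) (by lia)
      have hd := hdn (n + 3) (by lia)
      simp only [Nat.add_sub_cancel, show n + 3 - 2 = n + 1 by lia,
        show n + 3 - 1 = n + 2 by lia] at ha hd
      have h1 : cfA (K 0) a d (n + 2) = _ := ih (n + 1) (by lia)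
      have h2 : cfA (K 0) a d (n + 3) = _ := ih (n + 2) (by lia)
      have hB := cfB_bernoulli_succ K a d hd1 ha2 hd2 han hdn n
      rw [cfA, cfB, h1, h2, ha, hd]
      linear_combination (K (n + 2) - K (n + 3)) * (K (n + 3) - K (n + 1)) * hB

theorem bernoulli_cf (K : ℕ → ℂ) (a d : ℕ → ℂ)
    (hK : ∀ i : ℕ, 1 ≤ i → K i ≠ K (i - 1))
    (ha1 : a 1 = K 1 - K 0)
    (hd1 : d 1 = 1)
    (ha2 : a 2 = K 1 - K 2)
    (hd2 : d 2 = K 2 - K 0)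
    (han : ∀ n : ℕ, 3 ≤ n → a n = (K (n - 2) - K (n - 3)) * (K (n - 1) - K n))
    (hdn : ∀ n : ℕ, 3 ≤ n → d n = K n - K (n - 2)) :
    ∀ N : ℕ, cfB (K 0) a d (N + 1) ≠ 0 ∧
      cfA (K 0) a d (N + 1) = K N * cfB (K 0) a d (N + 1) := by
  intro N
  refine ⟨?_, cfA_bernoulli K a d ha1 hd1 ha2 hd2 han hdn N⟩
  cases N with
  | zero => simp [cfB]
  | succ n =>
    exact cfB_bernoulli_ne_zero K a d hK hd1
      (cfB_bernoulli_succ K a d hd1 ha2 hd2 han hdn) n
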